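/- (Theorem 2, data reconstruction counting) In the Algorithm-2 storage structure with L ≥ 1, nI ≥ 2, n = L·nI and χ ≥ 1, let k be an integer with 1 ≤ k ≤ n, set q = ⌊k/nI⌋, r = k mod nI and α = (nI − 1)χ + (n − nI). Then for every set S of k distinct nodes, the number of distinct coded symbols stored on at least one node of S is at least k·α − (χ−1)·(q·nI² + r² − k)/2 − k(k−1)/2. (Hence, since the θ = (χ−1)·C(nI,2)·L + C(n,2) coded symbols are obtained from M = k·α − (χ−1)(q·nI² + r² − k)/2 − k(k−1)/2 source symbols by a (θ, M)-MDS code, any k nodes suffice to recover the original file.) -/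

import Mathlib

/-- Node `(l,j)` (0-indexed) of the clustered system is identified with element
`nI·l + j` of `{0,…,L·nI − 1}`. -/
def clusterIdx {L nI : ℕ} (v : Fin L × Fin nI) : Fin (L * nI) :=
  ⟨nI * v.1.val + v.2.val, by
    have h1 : v.1.val + 1 ≤ L := v.1.isLt
    have h2 : v.2.val < nI := v.2.isLt
    calc nI * v.1.val + v.2.val < nI * v.1.val + nI := Nat.add_lt_add_left h2 _
      _ = nI * (v.1.val + 1) := by ring
      _ ≤ nI * L := Nat.mul_le_mul_left nI h1
      _ = L * nI := Nat.mul_comm nI L⟩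

/-- The coded symbols of the Algorithm-2 storage structure: a global symbol for each edge
of the complete graph on the `n = L·nI` node indices, and a local symbol for each cluster
`l`, each `t ∈ {1,…,χ−1}` and each edge of the complete graph on `{1,…,nI}`. -/
def AlgTwoSymbol (L nI χ : ℕ) : Type :=
  {e : Sym2 (Fin (L * nI)) // ¬ e.IsDiag} ⊕
    (Fin L × Fin (χ - 1) × {e : Sym2 (Fin nI) // ¬ e.IsDiag})

/-- Node `(l,j)` stores a global symbol `e` iff its index is an endpoint of `e`, and stores
a local symbol `(l',t,e')` iff `l = l'` and `j` is an endpoint of `e'`. -/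
def algTwoStores {L nI χ : ℕ} (v : Fin L × Fin nI) (s : AlgTwoSymbol L nI χ) : Prop :=
  match s with
  | Sum.inl e => clusterIdx v ∈ e.val
  | Sum.inr w => v.1 = w.1 ∧ v.2 ∈ w.2.2.val


/-- The edges of the complete graph on `V` that meet a vertex set `T`. -/
def edgesMeeting {V : Type*} [Fintype V] [DecidableEq V] (T : Finset V) :
    Finset {e : Sym2 V // ¬ e.IsDiag} :=
  Finset.univ.filter fun e => ∃ v ∈ T, v ∈ e.val

/-- Twice the number of edges of the complete graph on `V` that meet a vertex set `T`. -/
lemma two_mul_card_edgesMeeting {V : Type*} [Fintype V] [DecidableEq V] (T : Finset V) :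
    (2 : ℤ) * (edgesMeeting T).card =
      T.card * (2 * (Fintype.card V : ℤ) - 1 - T.card) := by
  have hcompl : (Finset.univ.filter
      fun e : {e : Sym2 V // ¬ e.IsDiag} => ¬ ∃ v ∈ T, v ∈ e.val).card =
      (Tᶜ.card).choose 2 := by
    rw [← Sym2.card_image_offDiag,
      ← Finset.card_map (Function.Embedding.subtype fun e : Sym2 V => ¬ e.IsDiag)]
    congr 1
    ext e
    induction e with | _ x y
    simp only [Finset.mem_map, Finset.mem_filter, Finset.mem_univ, true_and,
      Function.Embedding.coe_subtype, Subtype.exists, Finset.mem_image, Finset.mem_offDiag,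
      Finset.mem_compl, Prod.exists]
    constructor
    · rintro ⟨e, he, h, rfl⟩
      refine ⟨x, y, ⟨fun hx => h ⟨x, hx, by simp⟩, fun hy => h ⟨y, hy, by simp⟩, ?_⟩, rfl⟩
      simpa using he
    · rintro ⟨a, b, ⟨ha, hb, hab⟩, he⟩
      refine ⟨s(a, b), by simpa using hab, ?_, he⟩
      rintro ⟨v, hv, hve⟩
      rcases Sym2.mem_iff.mp hve with rfl | rfl
      · exact ha hv
      · exact hb hv
  have htotal := Finset.card_filter_add_card_filter_not
    (s := (Finset.univ : Finset {e : Sym2 V // ¬ e.IsDiag})) (fun e => ∃ v ∈ T, v ∈ e.val)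
  rw [hcompl, Finset.card_univ, Sym2.card_subtype_not_diag] at htotal
  have hT := T.card_add_card_compl
  rw [edgesMeeting]
  qify at htotal hT ⊢
  rw [Nat.cast_choose_two, Nat.cast_choose_two, ← hT] at htotal
  rw [← hT]
  linarith

/-- Among sequences with entries at most `m`, concentrating the sum into full blocks of size `m`
maximizes the sum of squares. -/
lemma sum_sq_le_div_mul_sq_add_mod_sq {ι : Type*} (s : Finset ι) (a : ι → ℕ) {m : ℕ}
    (ha : ∀ i ∈ s, a i ≤ m) :
    ∑ i ∈ s, a i ^ 2 ≤ (∑ i ∈ s, a i) / m * m ^ 2 + ((∑ i ∈ s, a i) % m) ^ 2 := by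
  classical
  rcases Nat.eq_zero_or_pos m with rfl | hm
  · rw [Finset.sum_eq_zero fun i hi => by simp [Nat.le_zero.mp (ha i hi)]]
    exact Nat.zero_le _
  induction s using Finset.induction_on with
  | empty => simp
  | insert i s hi ih =>
    rw [Finset.sum_insert hi, Finset.sum_insert hi]
    have ih := ih fun j hj => ha j (Finset.mem_insert_of_mem hj)
    have him := ha i (Finset.mem_insert_self i s)
    generalize ∑ j ∈ s, a j = k at *
    generalize a i = b at *
    have hdiv := Nat.div_add_mod k m
    have hmod := Nat.mod_lt k hm
    generalize k / m = q at *
    generalize k % m = r at *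
    rcases lt_or_ge (b + r) m with h | h
    · obtain ⟨h1, h2⟩ := (Nat.div_mod_unique (a := b + k) (d := q) (c := b + r) hm).mpr
        ⟨by omega, h⟩
      rw [h1, h2]
      nlinarith [Nat.zero_le (b * r)]
    · obtain ⟨c, hc⟩ := Nat.exists_eq_add_of_le h
      obtain ⟨h1, h2⟩ := (Nat.div_mod_unique (a := b + k) (d := q + 1) (c := c) hm).mpr
        ⟨by rw [mul_add]; omega, by omega⟩
      rw [h1, h2]
      obtain ⟨d, rfl⟩ := Nat.exists_eq_add_of_le him
      obtain rfl : r = d + c := by omega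
      nlinarith [Nat.zero_le (d * (b - c)), mul_le_mul_right (show c ≤ b by omega) d]

lemma clusterIdx_injective {L nI : ℕ} :
    Function.Injective (clusterIdx : Fin L × Fin nI → Fin (L * nI)) := by
  rintro ⟨l, i⟩ ⟨l', i'⟩ h
  have h : nI * l.val + i.val = nI * l'.val + i'.val := congrArg Fin.val h
  have hpos : 0 < nI := i.pos
  have h1 := (Nat.div_mod_unique (a := nI * l.val + i.val) hpos).mpr ⟨add_comm _ _, i.isLt⟩
  have h2 := (Nat.div_mod_unique (a := nI * l'.val + i'.val) hpos).mpr ⟨add_comm _ _, i'.isLt⟩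
  rw [h] at h1
  ext
  · exact h1.1.symm.trans h2.1
  · exact h1.2.symm.trans h2.2

/-- The positions, within cluster `l`, of the nodes of `S`. -/
def clusterPart {L nI : ℕ} (S : Finset (Fin L × Fin nI)) (l : Fin L) : Finset (Fin nI) :=
  Finset.univ.filter fun j => (l, j) ∈ S

lemma sum_card_clusterPart {L nI : ℕ} (S : Finset (Fin L × Fin nI)) :
    ∑ l, (clusterPart S l).card = S.card := by
  simp only [clusterPart, Finset.card_filter]
  rw [← Fintype.sum_prod_type' (f := fun l j => if (l, j) ∈ S then 1 else 0)]
  simp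

/-- The symbols stored on `S`, split into global ones and local ones per cluster. -/
lemma ncard_stored {L nI χ : ℕ} (S : Finset (Fin L × Fin nI)) :
    {s : AlgTwoSymbol L nI χ | ∃ v ∈ S, algTwoStores v s}.ncard =
      (edgesMeeting (S.image clusterIdx)).card +
      (χ - 1) * ∑ l, (edgesMeeting (clusterPart S l)).card := by
  let U : Finset (AlgTwoSymbol L nI χ) :=
    Finset.disjSum (edgesMeeting (S.image clusterIdx))
      (Finset.univ.filter fun w : Fin L × Fin (χ - 1) × {e : Sym2 (Fin nI) // ¬ e.IsDiag} =>
        w.2.2 ∈ edgesMeeting (clusterPart S w.1))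
  have hset : {s : AlgTwoSymbol L nI χ | ∃ v ∈ S, algTwoStores v s} = (U : Set _) := by
    ext s
    rw [Finset.mem_coe]
    rcases s with e | ⟨l, t, e⟩
    · refine Iff.trans ?_ Finset.inl_mem_disjSum.symm
      change (∃ v ∈ S, clusterIdx v ∈ e.val) ↔ _
      simp [edgesMeeting]
    · refine Iff.trans ?_ Finset.inr_mem_disjSum.symm
      simp only [algTwoStores, clusterPart, edgesMeeting, Finset.mem_filter, Finset.mem_univ,
        true_and]
      constructor
      · rintro ⟨⟨_, j⟩, hv, rfl, hj⟩
        exact ⟨j, hv, hj⟩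
      · rintro ⟨j, hv, hj⟩
        exact ⟨(l, j), hv, rfl, hj⟩
  rw [hset, Set.ncard_coe_finset]
  refine (Finset.card_disjSum _ _).trans ?_
  congr 1
  rw [Finset.card_filter]
  simp only [Finset.sum_ite_mem, Finset.univ_inter, Finset.sum_const, Fintype.sum_prod_type,
    Finset.card_univ, Fintype.card_fin, smul_eq_mul, Finset.mul_sum, mul_one]

/-- Theorem 2 (data reconstruction counting): in the Algorithm-2 storage structure with
`α = (nI−1)χ + (n−nI)`, any set of `k` nodes retrieves at least
`kα − (χ−1)(q nI² + r² − k)/2 − k(k−1)/2` distinct coded symbols. -/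
theorem algorithm2_reconstruction_bound (L nI χ : ℕ) (hL : 1 ≤ L) (hnI : 2 ≤ nI) (hχ : 1 ≤ χ)
    (n : ℕ) (hn : n = L * nI) (k : ℕ) (hk1 : 1 ≤ k) (hk2 : k ≤ n)
    (q r : ℕ) (hq : q = k / nI) (hr : r = k % nI)
    (α : ℕ) (hα : α = (nI - 1) * χ + (n - nI))
    (S : Finset (Fin L × Fin nI)) (hS : S.card = k) :
    (({s : AlgTwoSymbol L nI χ | ∃ v ∈ S, algTwoStores v s}.ncard : ℤ)) ≥
      (k : ℤ) * (α : ℤ) - ((χ : ℤ) - 1) * ((q : ℤ) * (nI : ℤ) ^ 2 + (r : ℤ) ^ 2 - (k : ℤ)) / 2 -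
        (k : ℤ) * ((k : ℤ) - 1) / 2 := by
  rw [ncard_stored]
  have hglobal := two_mul_card_edgesMeeting (S.image clusterIdx)
  rw [Finset.card_image_of_injective _ clusterIdx_injective, hS, Fintype.card_fin]
    at hglobal
  have hsum := sum_card_clusterPart S
  rw [hS] at hsum
  have hsq := sum_sq_le_div_mul_sq_add_mod_sq Finset.univ (fun l => (clusterPart S l).card)
    (m := nI) fun l _ => by simpa using (clusterPart S l).card_le_univ
  rw [hsum, ← hq, ← hr] at hsq
  have hlocal : (2 : ℤ) * ((∑ l, (edgesMeeting (clusterPart S l)).card : ℕ) : ℤ) =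
      k * (2 * nI - 1) - (∑ l, (clusterPart S l).card ^ 2 : ℕ) := by
    rw [← hsum]
    push_cast
    rw [Finset.mul_sum, Finset.sum_mul, ← Finset.sum_sub_distrib]
    refine Finset.sum_congr rfl fun l _ => ?_
    rw [two_mul_card_edgesMeeting, Fintype.card_fin]
    ring
  have hn_le : nI ≤ n := hn ▸ Nat.le_mul_of_pos_left nI hL
  generalize (edgesMeeting (S.image clusterIdx)).card = G at *
  rw [← hn] at hglobal
  generalize ∑ l, (edgesMeeting (clusterPart S l)).card = N at *
  generalize ∑ l, (clusterPart S l).card ^ 2 = Q at *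
  obtain ⟨x, rfl⟩ : ∃ x, χ = x + 1 := ⟨χ - 1, by omega⟩
  have hkdiv : (k : ℤ) = nI * q + r := by
    rw [hq, hr]
    exact_mod_cast (Nat.div_add_mod k nI).symm
  obtain ⟨y, hy⟩ : (2 : ℤ) ∣ q * nI ^ 2 + r ^ 2 - k := by
    have h1 := (Int.even_mul_pred_self (nI : ℤ)).two_dvd
    have h2 := (Int.even_mul_pred_self (r : ℤ)).two_dvd
    have h3 : (q : ℤ) * nI ^ 2 + r ^ 2 - k = q * (nI * (nI - 1)) + r * (r - 1) := by
      rw [hkdiv]; ring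
    rw [h3]
    exact dvd_add (h1.mul_left _) h2
  obtain ⟨z, hz⟩ := (Int.even_mul_pred_self (k : ℤ)).two_dvd
  have hα' : (α : ℤ) = (nI - 1) * (x + 1) + (n - nI) := by
    rw [hα]
    push_cast [Nat.cast_sub (show 1 ≤ nI by omega), Nat.cast_sub hn_le]
    ring
  have hsq' : (Q : ℤ) ≤ q * nI ^ 2 + r ^ 2 := by exact_mod_cast hsq
  rw [hy, hz, mul_left_comm, Int.mul_ediv_cancel_left _ two_ne_zero,
    Int.mul_ediv_cancel_left _ two_ne_zero, hα', Nat.add_sub_cancel]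
  push_cast
  have hN : (k : ℤ) * (nI - 1) - y ≤ N := by linarith
  have hxN := mul_le_mul_of_nonneg_left hN (Int.natCast_nonneg x)
  linarith
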